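/- Let q ≥ 2 be an integer and β > q, and let a be the unique fixed point of F in (1/q, 1]. Writing ϑ := θ(aβ), the derivative of F at a satisfies F′(a) = ((q−1)/q) · ϑ² / (ϑ + (1 − ϑ)·log(1 − ϑ)), and moreover F′(a) ≥ (q−1)/q. -/

import Mathlib

open scoped Classical
open Finset

/-- Spin configurations on `n` vertices with `q` spins. -/
abbrev Conf (n q : ℕ) := Fin n → Fin q

/-- Number of vertices assigned spin `j`. -/
def cntN {n q : ℕ} (X : Conf n q) (j : Fin q) : ℕ :=
  (Finset.univ.filter (fun v => X v = j)).card

/-- Number of monochromatic pairs `{u,v}` (`u < v`, same spin). -/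
def numMono {n q : ℕ} (σ : Conf n q) : ℕ :=
  (Finset.univ.filter (fun p : Fin n × Fin n => p.1 < p.2 ∧ σ p.1 = σ p.2)).card

/-- The mean-field `q`-state Potts measure: probability of `σ`. -/
noncomputable def pottsProb (n q : ℕ) (β : ℝ) (σ : Conf n q) : ℝ :=
  Real.exp (β / n * numMono σ) / ∑ τ : Conf n q, Real.exp (β / n * numMono τ)

/-- The set of monochromatic pairs of a configuration. -/
def monoPairs {n q : ℕ} (σ : Conf n q) : Finset (Fin n × Fin n) :=
  Finset.univ.filter (fun p : Fin n × Fin n => p.1 < p.2 ∧ σ p.1 = σ p.2)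

/-- The graph on `Fin n` whose edges are the pairs in `E`. -/
def graphOf {n : ℕ} (E : Finset (Fin n × Fin n)) : SimpleGraph (Fin n) :=
  SimpleGraph.fromRel (fun u v => (u, v) ∈ E)

/-- Number of connected components of the graph `(V, E)`. -/
noncomputable def numComps {n : ℕ} (E : Finset (Fin n × Fin n)) : ℕ :=
  Nat.card (graphOf E).ConnectedComponent

/-- One-step transition probability of the Swendsen–Wang dynamics:
percolate on monochromatic pairs with probability `p = 1 - exp (-β/n)`,
then color each connected component uniformly at random. -/
noncomputable def swStep (n q : ℕ) (β : ℝ) (σ τ : Conf n q) : ℝ :=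
  ∑ E ∈ (monoPairs σ).powerset,
    ((1 - Real.exp (-(β / n))) ^ E.card *
        Real.exp (-(β / n)) ^ ((monoPairs σ).card - E.card)) *
      (if ∀ u v : Fin n, (graphOf E).Reachable u v → τ u = τ v then
        ((q : ℝ))⁻¹ ^ numComps E else 0)

/-- `t`-step transition probability of the Swendsen–Wang dynamics. -/
noncomputable def swProb (n q : ℕ) (β : ℝ) : ℕ → Conf n q → Conf n q → ℝ
  | 0, σ, τ => if σ = τ then 1 else 0
  | t + 1, σ, τ => ∑ η : Conf n q, swStep n q β σ η * swProb n q β t η τ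

/-- Probability of observing the trajectory `ω 0, ω 1, …, ω (ℓ-1)` at times
`1, …, ℓ` for the SW dynamics started at `X₀`. -/
noncomputable def pathProb (n q : ℕ) (β : ℝ) (X₀ : Conf n q) (ℓ : ℕ)
    (ω : Fin ℓ → Conf n q) : ℝ :=
  ∏ i : Fin ℓ, swStep n q β
    (if _h : 0 < (i : ℕ) then
        ω ⟨(i : ℕ) - 1, lt_of_le_of_lt (Nat.sub_le _ _) i.isLt⟩
      else X₀) (ω i)

/-- Total variation distance between two probability vectors on configurations. -/
noncomputable def tvDist {n q : ℕ} (f g : Conf n q → ℝ) : ℝ :=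
  (∑ τ : Conf n q, |f τ - g τ|) / 2

/-- Mixing time `τ_mix(ε)` of the SW dynamics. -/
noncomputable def mixingTime (n q : ℕ) (β ε : ℝ) : ℕ :=
  sInf {t : ℕ | ∀ σ : Conf n q, tvDist (swProb n q β t σ) (pottsProb n q β) ≤ ε}

/-- `theta lam` is the unique root in `(0,1)` of `exp (-lam * x) = 1 - x`
for `lam > 1`, and `0` for `lam ≤ 1`. -/
noncomputable def theta (lam : ℝ) : ℝ :=
  if lam ≤ 1 then 0
  else sSup {x : ℝ | x ∈ Set.Ioo (0 : ℝ) 1 ∧ Real.exp (-lam * x) = 1 - x}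

/-- The drift function `F`. -/
noncomputable def F (q : ℕ) (β : ℝ) (x : ℝ) : ℝ :=
  1 / q + (1 - 1 / q) * theta (β * x) * x

/-- The unique fixed point of `F` in `(1/q, 1]` (for `β > q`). -/
noncomputable def aFix (q : ℕ) (β : ℝ) : ℝ :=
  sSup {x : ℝ | x ∈ Set.Ioc (1 / (q : ℝ)) 1 ∧ F q β x = x}

/-- The cutoff constant `c(β,q) = (2 log (1 / F'(a)))⁻¹`. -/
noncomputable def cConst (q : ℕ) (β : ℝ) : ℝ :=
  (2 * Real.log (1 / deriv (F q β) (aFix q β)))⁻¹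

/-- Fraction of vertices assigned spin `j`. -/
noncomputable def cntFrac {n q : ℕ} (X : Conf n q) : Fin q → ℝ :=
  fun j => (cntN X j : ℝ) / n

/-- The proportions vector `α(X)`: fractions of vertices of each spin,
sorted in nonincreasing order. -/
noncomputable def alphaVec {n q : ℕ} (X : Conf n q) : Fin q → ℝ :=
  fun i => cntFrac X (Tuple.sort (cntFrac X) i.rev)

/-- `ℓ∞` distance between two vectors indexed by `Fin q`. -/
noncomputable def linf {q : ℕ} (f g : Fin q → ℝ) : ℝ :=
  ⨆ i : Fin q, |f i - g i|

/-- The vector `κ(b) = (b, (1-b)/(q-1), …, (1-b)/(q-1))`. -/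
noncomputable def kappaVec (q : ℕ) (b : ℝ) : Fin q → ℝ :=
  fun i => if (i : ℕ) = 0 then b else (1 - b) / ((q : ℝ) - 1)

/-- The majority vector `m = (a, (1-a)/(q-1), …, (1-a)/(q-1))`. -/
noncomputable def mVec (q : ℕ) (β : ℝ) : Fin q → ℝ :=
  kappaVec q (aFix q β)

/-- Index of the most common spin of `X` (least such index on ties). -/
noncomputable def domIdx {n q : ℕ} (X : Conf n q) : ℕ :=
  sInf {j : ℕ | ∃ hj : j < q, ∀ j' : Fin q, cntN X j' ≤ cntN X ⟨j, hj⟩}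

/-- `α₁(X)`: fraction of vertices carrying the most common spin of `X`. -/
noncomputable def alpha1 {n q : ℕ} (X : Conf n q) : ℝ :=
  ((Finset.univ.filter (fun v : Fin n => (X v : ℕ) = domIdx X)).card : ℝ) / n

/-- `α_{1,k}(X)`: fraction of vertices of `Vk` carrying the most common spin of `X`. -/
noncomputable def alpha1In {n q : ℕ} (X : Conf n q) (Vk : Finset (Fin n)) : ℝ :=
  ((Vk.filter (fun v => (X v : ℕ) = domIdx X)).card : ℝ) / Vk.card

/-- `P` is a partition of the vertex set into `q` classes. -/
def IsPartition {n q : ℕ} (P : Fin q → Finset (Fin n)) : Prop :=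
  (∀ i j, i ≠ j → Disjoint (P i) (P j)) ∧ ∀ v : Fin n, ∃ i, v ∈ P i

/-- A `λ`-partition: a partition with all classes of size at least `λ n`. -/
def IsLamPartition {n q : ℕ} (lam : ℝ) (P : Fin q → Finset (Fin n)) : Prop :=
  IsPartition P ∧ ∀ i, lam * n ≤ ((P i).card : ℝ)

/-- Projection: `projCnt P X i j` is the number of vertices of `P i`
assigned spin `j` in `X`. -/
def projCnt {n q : ℕ} (P : Fin q → Finset (Fin n)) (X : Conf n q) :
    Fin q → Fin q → ℕ :=
  fun i j => ((P i).filter (fun v => X v = j)).card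

/-- All potential edges of the complete graph on `Fin n`. -/
def allPairs (n : ℕ) : Finset (Fin n × Fin n) :=
  Finset.univ.filter (fun p : Fin n × Fin n => p.1 < p.2)

/-- Probability of the edge set `E` under the Erdős–Rényi measure `G(n,p)`. -/
noncomputable def erProb (n : ℕ) (p : ℝ) (E : Finset (Fin n × Fin n)) : ℝ :=
  p ^ E.card * (1 - p) ^ ((allPairs n).card - E.card)

/-- Size of the connected component of `v` in the graph `(V, E)`. -/
noncomputable def compCard {n : ℕ} (E : Finset (Fin n × Fin n)) (v : Fin n) : ℕ :=
  (Finset.univ.filter (fun u => (graphOf E).Reachable v u)).card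

/-- `L₁`: size of the largest connected component. -/
noncomputable def L1 {n : ℕ} (E : Finset (Fin n × Fin n)) : ℕ :=
  Finset.univ.sup (fun v => compCard E v)

/-- Sum of the squares of the component sizes, `Σ_j L_j²`
(computed as `Σ_v |C(v)|`). -/
noncomputable def sumCompSq {n : ℕ} (E : Finset (Fin n × Fin n)) : ℕ :=
  ∑ v : Fin n, compCard E v

/-- Expectation of `f` under the Erdős–Rényi measure `G(n,p)`. -/
noncomputable def erExp (n : ℕ) (p : ℝ) (f : Finset (Fin n × Fin n) → ℝ) : ℝ :=
  ∑ E ∈ (allPairs n).powerset, erProb n p E * f E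

/-- Random-cluster weight of an edge set with parameters `q`, `p = 1 - exp (-β/n)`. -/
noncomputable def rcWeight (n q : ℕ) (β : ℝ) (E : Finset (Fin n × Fin n)) : ℝ :=
  (1 - Real.exp (-(β / n))) ^ E.card *
    Real.exp (-(β / n)) ^ ((allPairs n).card - E.card) * (q : ℝ) ^ numComps E

/-- The mean-field random-cluster measure: probability of the edge set `E`. -/
noncomputable def rcProb (n q : ℕ) (β : ℝ) (E : Finset (Fin n × Fin n)) : ℝ :=
  rcWeight n q β E / ∑ B ∈ (allPairs n).powerset, rcWeight n q β B

lemma pos_add_mul_log_one_sub {x : ℝ} (hx : x ∈ Set.Ioo (0 : ℝ) 1) :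
    0 < x + (1 - x) * Real.log (1 - x) := by
  have hu : 0 < 1 - x := by linarith [hx.2]
  have h := Real.log_lt_sub_one_of_pos (inv_pos.2 hu)
    (by rw [Ne, inv_eq_one]; linarith [hx.1])
  rw [Real.log_inv] at h
  have h2 := mul_lt_mul_of_pos_left h hu
  have h3 : (1 - x) * (1 - x)⁻¹ = 1 := mul_inv_cancel₀ hu.ne'
  nlinarith

/-- The inverse of `theta` on `(0,1)`: the parameter whose nonzero root is `x`. -/
noncomputable def thetaInv (x : ℝ) : ℝ := -Real.log (1 - x) / x

lemma thetaInv_eq_iff {x lam : ℝ} (hx : x ∈ Set.Ioo (0 : ℝ) 1) :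
    thetaInv x = lam ↔ Real.exp (-lam * x) = 1 - x := by
  have hu : 0 < 1 - x := by linarith [hx.2]
  rw [thetaInv, div_eq_iff hx.1.ne', ← Real.exp_log hu, Real.exp_eq_exp, Real.exp_log hu]
  constructor <;> intro h <;> linarith

lemma hasStrictDerivAt_thetaInv {x : ℝ} (hx : x ∈ Set.Ioo (0 : ℝ) 1) :
    HasStrictDerivAt thetaInv
      ((x + (1 - x) * Real.log (1 - x)) / ((1 - x) * x ^ 2)) x := by
  have hu : 1 - x ≠ 0 := by linarith [hx.2]
  have hx0 : x ≠ 0 := hx.1.ne'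
  have h := ((((hasStrictDerivAt_id x).const_sub 1).log hu).neg).div (hasStrictDerivAt_id x) hx0
  refine h.congr_deriv ?_
  simp only [id, Pi.neg_apply]
  field_simp
  ring

lemma deriv_thetaInv_pos {x : ℝ} (hx : x ∈ Set.Ioo (0 : ℝ) 1) :
    0 < (x + (1 - x) * Real.log (1 - x)) / ((1 - x) * x ^ 2) :=
  div_pos (pos_add_mul_log_one_sub hx)
    (mul_pos (by linarith [hx.2]) (pow_pos hx.1 2))

lemma strictMonoOn_thetaInv : StrictMonoOn thetaInv (Set.Ioo 0 1) := by
  refine strictMonoOn_of_deriv_pos (convex_Ioo 0 1)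
    (fun x hx => (hasStrictDerivAt_thetaInv hx).hasDerivAt.continuousAt.continuousWithinAt) ?_
  intro x hx
  rw [interior_Ioo] at hx
  rw [(hasStrictDerivAt_thetaInv hx).hasDerivAt.deriv]
  exact deriv_thetaInv_pos hx

lemma exists_thetaInv_eq {lam : ℝ} (hlam : 1 < lam) :
    ∃ x ∈ Set.Ioo (0 : ℝ) 1, thetaInv x = lam := by
  have hl0 : 0 < lam := by linarith
  have hlog : 0 < Real.log lam := Real.log_pos hlam
  have hlog' : Real.log lam < lam - 1 := Real.log_lt_sub_one_of_pos hl0 hlam.ne'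
  set c := Real.log lam / lam with hc
  have hc0 : 0 < c := div_pos hlog hl0
  have hc1 : c < 1 := by rw [hc, div_lt_one hl0]; linarith
  have hlc : lam * c = Real.log lam := by rw [hc]; field_simp
  have hec : Real.exp (-lam * c) = lam⁻¹ := by
    rw [neg_mul, hlc, Real.exp_neg, Real.exp_log hl0]
  have hcont : ContinuousOn (fun x : ℝ => 1 - x - Real.exp (-lam * x)) (Set.Icc c 1) := by
    fun_prop
  have hpos : 0 < 1 - c - Real.exp (-lam * c) := by
    have hinv : lam * lam⁻¹ = 1 := mul_inv_cancel₀ hl0.ne'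
    rw [hec]
    by_contra! hneg
    nlinarith
  have hneg : 1 - 1 - Real.exp (-lam * 1) < 0 := by
    linarith [Real.exp_pos (-lam * 1)]
  obtain ⟨x, hx, hx'⟩ := intermediate_value_Ioo' hc1.le hcont ⟨hneg, hpos⟩
  have hxI : x ∈ Set.Ioo (0 : ℝ) 1 := ⟨hc0.trans hx.1, hx.2⟩
  exact ⟨x, hxI, (thetaInv_eq_iff hxI).2 (by simp only at hx'; linarith)⟩

lemma one_lt_thetaInv {x : ℝ} (hx : x ∈ Set.Ioo (0 : ℝ) 1) : 1 < thetaInv x := by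
  have h := Real.log_lt_sub_one_of_pos (x := 1 - x) (by linarith [hx.2]) (by linarith [hx.1])
  rw [thetaInv, lt_div_iff₀ hx.1]
  linarith

lemma theta_thetaInv {x : ℝ} (hx : x ∈ Set.Ioo (0 : ℝ) 1) : theta (thetaInv x) = x := by
  rw [theta, if_neg (one_lt_thetaInv hx).not_ge]
  have : {y : ℝ | y ∈ Set.Ioo (0 : ℝ) 1 ∧ Real.exp (-thetaInv x * y) = 1 - y} = {x} := by
    ext y
    simp only [Set.mem_ofPred_eq, Set.mem_singleton_iff]
    constructor
    · rintro ⟨hy, h⟩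
      exact strictMonoOn_thetaInv.injOn hy hx ((thetaInv_eq_iff hy).2 h)
    · rintro rfl
      exact ⟨hx, (thetaInv_eq_iff hx).1 rfl⟩
  rw [this, csSup_singleton]

lemma theta_mem_Ioo {lam : ℝ} (hlam : 1 < lam) : theta lam ∈ Set.Ioo (0 : ℝ) 1 := by
  obtain ⟨x, hx, rfl⟩ := exists_thetaInv_eq hlam
  rwa [theta_thetaInv hx]

lemma thetaInv_theta {lam : ℝ} (hlam : 1 < lam) : thetaInv (theta lam) = lam := by
  obtain ⟨x, hx, rfl⟩ := exists_thetaInv_eq hlam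
  rw [theta_thetaInv hx]

lemma hasDerivAt_theta {lam : ℝ} (hlam : 1 < lam) :
    HasDerivAt theta
      ((theta lam + (1 - theta lam) * Real.log (1 - theta lam)) /
        ((1 - theta lam) * theta lam ^ 2))⁻¹ lam := by
  have hx := theta_mem_Ioo hlam
  have hs := hasStrictDerivAt_thetaInv hx
  have h := hs.to_local_left_inverse (g := theta) (deriv_thetaInv_pos hx).ne'
    (by filter_upwards [isOpen_Ioo.mem_nhds hx] with y hy using theta_thetaInv hy)
  rw [thetaInv_theta hlam] at h
  exact h.hasDerivAt

lemma hasDerivAt_F (q : ℕ) {β x : ℝ} (hx : 1 < β * x) :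
    HasDerivAt (F q β)
      ((1 - 1 / (q : ℝ)) * (theta (β * x) ^ 2 /
        (theta (β * x) + (1 - theta (β * x)) * Real.log (1 - theta (β * x))))) x := by
  have hI := theta_mem_Ioo hx
  have hlam := thetaInv_theta hx
  have hθ := (hasDerivAt_theta hx).comp x ((hasDerivAt_id x).const_mul β)
  have h := (((hθ.const_mul (1 - 1 / (q : ℝ))).mul (hasDerivAt_id x)).const_add (1 / (q : ℝ)))
  refine h.congr_deriv ?_
  have hD := (pos_add_mul_log_one_sub hI).ne'
  simp only [Function.comp, id]
  rw [thetaInv, div_eq_iff hI.1.ne'] at hlam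
  generalize theta (β * x) = t at *
  have hlog : Real.log (1 - t) = -(β * x * t) := by linarith
  rw [hlog] at hD ⊢
  have ht : t ≠ 0 := hI.1.ne'
  have ht1 : 1 - t ≠ 0 := by linarith [hI.2]
  rw [inv_div, mul_one, mul_one]
  rw [mul_assoc, mul_assoc, ← mul_add]
  congr 1
  rw [eq_div_iff hD, add_mul]
  have e : (1 - t) * t ^ 2 / (t + (1 - t) * -(β * x * t)) * (β * x) *
      (t + (1 - t) * -(β * x * t)) = (1 - t) * t ^ 2 * (β * x) := by
    rw [mul_right_comm, div_mul_cancel₀ _ hD]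
  rw [e]
  ring

lemma one_div_lt_aFix {q : ℕ} (hq : 2 ≤ q) {β : ℝ} (hβ : (q : ℝ) < β) :
    1 / (q : ℝ) < aFix q β := by
  have hq2 : (2 : ℝ) ≤ q := by exact_mod_cast hq
  have hq0 : (0 : ℝ) < q := by linarith
  have hqi : 1 / (q : ℝ) < 1 := by rw [div_lt_one hq0]; linarith
  have hqp : 0 < 1 / (q : ℝ) := by positivity
  have hsup : ∀ x : ℝ, 1 / (q : ℝ) ≤ x → 1 < β * x := by
    intro x hx
    have h1 : q * (1 / (q : ℝ)) = 1 := by field_simp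
    nlinarith
  have hcont : ContinuousOn (fun x => F q β x - x) (Set.Icc (1 / (q : ℝ)) 1) := fun x hx =>
    ((hasDerivAt_F q (hsup x hx.1)).continuousAt.sub continuousAt_id).continuousWithinAt
  have hleft : 0 < F q β (1 / q) - 1 / q := by
    have := mul_pos (mul_pos (sub_pos.2 hqi) (theta_mem_Ioo (hsup _ le_rfl)).1) hqp
    rw [F]
    linarith
  have hright : F q β 1 - 1 < 0 := by
    have := mul_pos (sub_pos.2 hqi) (sub_pos.2 (theta_mem_Ioo (hsup 1 hqi.le)).2)
    rw [F]
    linarith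
  obtain ⟨x, hx, hx'⟩ := intermediate_value_Ioo' hqi.le hcont ⟨hright, hleft⟩
  refine hx.1.trans_le (le_csSup ⟨1, fun y hy => hy.1.2⟩ ⟨⟨hx.1, hx.2.le⟩, ?_⟩)
  exact sub_eq_zero.1 hx'

/-- Fact 2.4: with `ϑ = θ(aβ)`,
`F'(a) = ((q-1)/q) · ϑ² / (ϑ + (1-ϑ) log(1-ϑ))`, and `F'(a) ≥ (q-1)/q`. -/
theorem drift_deriv_at_fixed_point (q : ℕ) (hq : 2 ≤ q) (β : ℝ) (hβ : (q : ℝ) < β) :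
    deriv (F q β) (aFix q β) =
        ((q : ℝ) - 1) / q * theta (β * aFix q β) ^ 2 /
          (theta (β * aFix q β) +
            (1 - theta (β * aFix q β)) * Real.log (1 - theta (β * aFix q β))) ∧
      ((q : ℝ) - 1) / q ≤ deriv (F q β) (aFix q β) := by
  have hq0 : (0 : ℝ) < q := by exact_mod_cast (by omega : 0 < q)
  have hq1 : (1 : ℝ) ≤ q := by exact_mod_cast (by omega : 1 ≤ q)
  have ha : 1 < β * aFix q β := by
    have h := one_div_lt_aFix hq hβ
    rw [div_lt_iff₀ hq0] at h
    have hpos : 0 < aFix q β := (by positivity : 0 < 1 / (q : ℝ)).trans (one_div_lt_aFix hq hβ)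
    nlinarith
  have hI := theta_mem_Ioo ha
  have hcoef : 1 - 1 / (q : ℝ) = ((q : ℝ) - 1) / q := by field_simp
  rw [(hasDerivAt_F q ha).deriv, hcoef]
  refine ⟨(mul_div_assoc _ _ _).symm, le_mul_of_one_le_right
    (div_nonneg (by linarith) hq0.le) ?_⟩
  rw [one_le_div (pos_add_mul_log_one_sub hI)]
  have hu : 0 < 1 - theta (β * aFix q β) := by linarith [hI.2]
  nlinarith [mul_le_mul_of_nonneg_left (Real.log_le_sub_one_of_pos hu) hu.le]
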